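/- arXiv:2512.08146 — 4 statements merged into one kernel-verified Lean document; each statement's English description precedes it below -/
import Mathlib

section
/- Fix integers d, p, m ≥ 1. Let G₁, …, G_m ∈ ℝ^{d×d} be symmetric matrices, z ∈ ℝ^d with zᵀ G_t z ≠ 0 for every t, θ₁, …, θ_m ∈ ℝ, and J ∈ ℝ^{d×p}. Set A := (1/m) ∑_t θ_t² Jᵀ G_t J, let B ∈ ℝ^{p×m} have t-th column (1/m) θ_t Jᵀ G_t z, let D₀ := diag((1/m) zᵀ G_t z : t), and let Γ := [[A, B], [Bᵀ, D₀]]. Assume S := (1/m) ∑_t θ_t² Jᵀ Δ_t J is invertible, where Δ_t := G_t − (G_t z zᵀ G_t)/(zᵀ G_t z). Then Γ is invertible, and for any vectors u₁, …, u_m ∈ ℝ^d, if b ∈ ℝ^{p+m} is the vector whose first p coordinates form the block (1/m) Jᵀ ∑_t θ_t u_t and whose (p+t)-th coordinate is (1/m) zᵀ u_t, then the vector of the first p coordinates of Γ⁻¹ b equals S⁻¹ Jᵀ (1/m) ∑_{t=1}^m θ_t (I_d − (G_t z zᵀ)/(zᵀ G_t z)) u_t. -/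
open Matrix

/-- Block elimination: if `D` and its Schur complement `A - B D⁻¹ C` are invertible, then so is the
block matrix, and the upper block of the solution of the block system solves the Schur system. -/
theorem isUnit_det_fromBlocks_and_inv_mulVec_inl {m n α : Type*} [Fintype m] [Fintype n]
    [DecidableEq m] [DecidableEq n] [CommRing α]
    (A : Matrix m m α) (B : Matrix m n α) (C : Matrix n m α) (D : Matrix n n α)
    (hD : IsUnit D.det) (hS : IsUnit (A - B * D⁻¹ * C).det) (b₁ : m → α) (b₂ : n → α) :
    IsUnit (fromBlocks A B C D).det ∧
      ∀ i, ((fromBlocks A B C D)⁻¹ *ᵥ Sum.elim b₁ b₂) (Sum.inl i) =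
        ((A - B * D⁻¹ * C)⁻¹ *ᵥ (b₁ - B *ᵥ (D⁻¹ *ᵥ b₂))) i := by
  let _ := invertibleOfIsUnitDet D hD
  have hΓ : IsUnit (fromBlocks A B C D).det := by
    rw [det_fromBlocks₂₂, invOf_eq_nonsing_inv]
    exact hD.mul hS
  refine ⟨hΓ, fun i => ?_⟩
  set x := (A - B * D⁻¹ * C)⁻¹ *ᵥ (b₁ - B *ᵥ (D⁻¹ *ᵥ b₂)) with hx
  have hSx : (A - B * D⁻¹ * C) *ᵥ x = b₁ - B *ᵥ (D⁻¹ *ᵥ b₂) := by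
    rw [hx, mulVec_mulVec, mul_nonsing_inv _ hS, one_mulVec]
  have hsol : fromBlocks A B C D *ᵥ Sum.elim x (D⁻¹ *ᵥ (b₂ - C *ᵥ x)) = Sum.elim b₁ b₂ := by
    rw [fromBlocks_mulVec]
    congr 1
    · rw [sub_mulVec, sub_eq_iff_eq_add] at hSx
      simp only [Sum.elim_comp_inl, Sum.elim_comp_inr, hSx, mulVec_sub, ← mulVec_mulVec]
      abel
    · simp only [Sum.elim_comp_inl, Sum.elim_comp_inr]
      rw [mulVec_mulVec _ D, mul_nonsing_inv _ hD, one_mulVec]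
      abel
  rw [← hsol, mulVec_mulVec, nonsing_inv_mul _ hΓ, one_mulVec, Sum.elim_inl]

/-- The first `p` coordinates of `Γ⁻¹ b`, where `Γ` is the Fisher information block matrix
and `b` is the score-type vector, are given by projecting each layer's contribution through
`I_d − G_t z zᵀ/(zᵀ G_t z)` (deterministic computation behind Theorem 4.1). -/
theorem fisher_inverse_applied_to_score
    (d p m : ℕ) (hd : 1 ≤ d) (hp : 1 ≤ p) (hm : 1 ≤ m)
    (G : Fin m → Matrix (Fin d) (Fin d) ℝ) (hG : ∀ t, (G t).IsSymm)
    (z : Fin d → ℝ) (hz : ∀ t, z ⬝ᵥ (G t) *ᵥ z ≠ 0)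
    (θ : Fin m → ℝ) (J : Matrix (Fin d) (Fin p) ℝ)
    (A : Matrix (Fin p) (Fin p) ℝ)
    (hA : A = (1 / (m : ℝ)) • ∑ t, (θ t) ^ 2 • (Jᵀ * G t * J))
    (B : Matrix (Fin p) (Fin m) ℝ)
    (hB : ∀ i t, B i t = (1 / (m : ℝ)) * θ t * ((Jᵀ * G t) *ᵥ z) i)
    (D₀ : Matrix (Fin m) (Fin m) ℝ)
    (hD₀ : D₀ = Matrix.diagonal (fun t => (1 / (m : ℝ)) * (z ⬝ᵥ (G t) *ᵥ z)))
    (S : Matrix (Fin p) (Fin p) ℝ)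
    (hS : S = (1 / (m : ℝ)) • ∑ t, (θ t) ^ 2 •
      (Jᵀ * (G t - (z ⬝ᵥ (G t) *ᵥ z)⁻¹ •
        Matrix.vecMulVec ((G t) *ᵥ z) (z ᵥ* (G t))) * J))
    (hSinv : IsUnit S.det)
    (u : Fin m → Fin d → ℝ)
    (b : Fin p ⊕ Fin m → ℝ)
    (hb : b = Sum.elim
      (fun i => (1 / (m : ℝ)) * (Jᵀ *ᵥ (∑ t, θ t • u t)) i)
      (fun t => (1 / (m : ℝ)) * (z ⬝ᵥ u t))) :
    IsUnit (Matrix.fromBlocks A B Bᵀ D₀).det ∧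
    ∀ i : Fin p,
      ((Matrix.fromBlocks A B Bᵀ D₀)⁻¹ *ᵥ b) (Sum.inl i) =
      (S⁻¹ *ᵥ (Jᵀ *ᵥ ((1 / (m : ℝ)) • ∑ t, θ t •
        ((1 - (z ⬝ᵥ (G t) *ᵥ z)⁻¹ • Matrix.vecMulVec ((G t) *ᵥ z) z) *ᵥ u t)))) i := by
  have hm0 : (m : ℝ) ≠ 0 := by positivity
  have hq : ∀ t, (1 / (m : ℝ)) * (z ⬝ᵥ G t *ᵥ z) ≠ 0 := fun t =>
    mul_ne_zero (one_div_ne_zero hm0) (hz t)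
  have hD : IsUnit D₀.det := by
    rw [hD₀, det_diagonal, isUnit_iff_ne_zero]
    exact Finset.prod_ne_zero_iff.2 fun t _ => hq t
  have hDinv : D₀⁻¹ = diagonal fun t => ((1 / (m : ℝ)) * (z ⬝ᵥ G t *ᵥ z))⁻¹ := by
    refine inv_eq_right_inv ?_
    rw [hD₀, diagonal_mul_diagonal, ← diagonal_one]
    exact congrArg diagonal (funext fun t => mul_inv_cancel₀ (hq t))
  have hzGJ : ∀ t, (z ᵥ* G t) ᵥ* J = (Jᵀ * G t) *ᵥ z := fun t => by
    rw [← mulVec_transpose J, ← mulVec_transpose (G t), (hG t).eq, mulVec_mulVec]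
  have hSchur : A - B * D₀⁻¹ * Bᵀ = S := by
    ext i j
    have hBDB : (B * D₀⁻¹ * Bᵀ) i j =
        ∑ t, B i t * ((1 / (m : ℝ)) * (z ⬝ᵥ G t *ᵥ z))⁻¹ * B j t := by
      rw [mul_apply]
      simp only [hDinv, mul_diagonal, transpose_apply]
    rw [Matrix.sub_apply, hBDB]
    simp only [hS, hA, hB, Matrix.mul_sub, Matrix.sub_mul, Matrix.sub_apply, Matrix.smul_apply,
      Matrix.sum_apply, Matrix.mul_smul, Matrix.smul_mul, mul_vecMulVec, vecMulVec_mul, hzGJ,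
      mulVec_mulVec, vecMulVec_apply, smul_eq_mul, Finset.mul_sum]
    rw [← Finset.sum_sub_distrib]
    refine Finset.sum_congr rfl fun t _ => ?_
    have := hz t
    field_simp
  have hrhs : (fun i => (1 / (m : ℝ)) * (Jᵀ *ᵥ ∑ t, θ t • u t) i) -
      B *ᵥ (D₀⁻¹ *ᵥ fun t => (1 / (m : ℝ)) * (z ⬝ᵥ u t)) =
      Jᵀ *ᵥ ((1 / (m : ℝ)) • ∑ t, θ t •
        ((1 - (z ⬝ᵥ G t *ᵥ z)⁻¹ • vecMulVec (G t *ᵥ z) z) *ᵥ u t)) := by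
    ext i
    have hBD : (B *ᵥ (D₀⁻¹ *ᵥ fun t => (1 / (m : ℝ)) * (z ⬝ᵥ u t))) i =
        ∑ t, B i t * (((1 / (m : ℝ)) * (z ⬝ᵥ G t *ᵥ z))⁻¹ * ((1 / (m : ℝ)) * (z ⬝ᵥ u t))) := by
      simp only [hDinv, mulVec_diagonal, mulVec_eq_sum (M := B)]
      simp [mul_comm]
    rw [Pi.sub_apply, hBD]
    simp only [hB, Pi.sub_apply, mulVec_smul, mulVec_sum, Pi.smul_apply, Finset.sum_apply,
      sub_mulVec, one_mulVec, smul_mulVec, vecMulVec_mulVec, mulVec_sub, op_smul_eq_smul,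
      mulVec_mulVec, smul_eq_mul, Finset.mul_sum]
    rw [← Finset.sum_sub_distrib]
    refine Finset.sum_congr rfl fun t _ => ?_
    have := hz t
    field_simp
  have h := isUnit_det_fromBlocks_and_inv_mulVec_inl A B Bᵀ D₀ hD (hSchur ▸ hSinv)
    (fun i => (1 / (m : ℝ)) * (Jᵀ *ᵥ ∑ t, θ t • u t) i) (fun t => (1 / (m : ℝ)) * (z ⬝ᵥ u t))
  rwa [hSchur, hrhs, ← hb] at h
end

section
/- Let K ≥ 1 and let T : ℝ^K → ℝ^K be the stick-breaking transformation. Then T is injective and its range equals {z ∈ ℝ^K : z_k > 0 for all k and ∑_{k=1}^K z_k < 1}; that is, T is a bijection from ℝ^K onto the interior of the reparameterization domain. -/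
/-- The logistic sigmoid `σ(t) = 1/(1 + e^{−t})`. -/
noncomputable def logistic (t : ℝ) : ℝ := 1 / (1 + Real.exp (-t))

/-- The stick-breaking transformation `(T x)_k = (1 − σ(x_k)) ∏_{j<k} σ(x_j)`. -/
noncomputable def stickBreak (K : ℕ) (x : Fin K → ℝ) : Fin K → ℝ :=
  fun k => (1 - logistic (x k)) * ∏ j ∈ Finset.Iio k, logistic (x j)

theorem logistic_eq_sigmoid : logistic = Real.sigmoid := by
  funext t
  rw [logistic, Real.sigmoid_def, one_div]

theorem stickBreak_apply_zero {n : ℕ} (x : Fin (n + 1) → ℝ) :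
    stickBreak (n + 1) x 0 = 1 - logistic (x 0) := by
  have h : Finset.Iio (0 : Fin (n + 1)) = ∅ := by ext; simp
  simp [stickBreak, h]

theorem stickBreak_apply_succ {n : ℕ} (x : Fin (n + 1) → ℝ) (k : Fin n) :
    stickBreak (n + 1) x k.succ = logistic (x 0) * stickBreak n (Fin.tail x) k := by
  have h : ∏ j ∈ Finset.Iio k.succ, logistic (x j) =
      logistic (x 0) * ∏ j ∈ Finset.Iio k, logistic (x j.succ) := by
    simp only [← Finset.filter_gt_eq_Iio, Finset.prod_filter, Fin.prod_univ_succ,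
      Fin.succ_pos, if_true, Fin.succ_lt_succ_iff]
  simp only [stickBreak, h, Fin.tail]
  ring

theorem stickBreak_injective (n : ℕ) : Function.Injective (stickBreak n) := by
  induction n with
  | zero => exact Function.injective_of_subsingleton _
  | succ n ih =>
    intro x y hxy
    have h0 : logistic (x 0) = logistic (y 0) := by
      simpa [stickBreak_apply_zero] using congrFun hxy 0
    have htail : Fin.tail x = Fin.tail y := by
      refine ih (funext fun k => ?_)
      have hk := congrFun hxy k.succ
      rw [stickBreak_apply_succ, stickBreak_apply_succ, h0, logistic_eq_sigmoid] at hk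
      exact mul_left_cancel₀ (Real.sigmoid_pos _).ne' hk
    rw [logistic_eq_sigmoid, Real.sigmoid_inj] at h0
    rw [← Fin.cons_self_tail x, ← Fin.cons_self_tail y, h0, htail]

theorem stickBreak_pos {n : ℕ} (x : Fin n → ℝ) (k : Fin n) : 0 < stickBreak n x k := by
  rw [stickBreak, logistic_eq_sigmoid]
  exact mul_pos (sub_pos.2 (Real.sigmoid_lt_one _))
    (Finset.prod_pos fun j _ => Real.sigmoid_pos (x j))

theorem sum_stickBreak_lt_one {n : ℕ} (x : Fin n → ℝ) : ∑ k, stickBreak n x k < 1 := by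
  induction n with
  | zero => simp
  | succ n ih =>
    simp only [Fin.sum_univ_succ, stickBreak_apply_zero, stickBreak_apply_succ,
      ← Finset.mul_sum, logistic_eq_sigmoid]
    have := mul_lt_mul_of_pos_left (ih (Fin.tail x)) (Real.sigmoid_pos (x 0))
    linarith

theorem exists_stickBreak_eq {n : ℕ} (z : Fin n → ℝ) (hpos : ∀ k, 0 < z k)
    (hsum : ∑ k, z k < 1) : ∃ x, stickBreak n x = z := by
  induction n with
  | zero => exact ⟨z, Subsingleton.elim _ _⟩
  | succ n ih =>
    rw [Fin.sum_univ_succ] at hsum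
    have htail : 0 ≤ ∑ k : Fin n, z k.succ := Finset.sum_nonneg fun k _ => (hpos _).le
    have hz : 0 < 1 - z 0 := by linarith
    obtain ⟨a, ha⟩ : 1 - z 0 ∈ Set.range Real.sigmoid := by
      rw [Real.range_sigmoid]
      exact ⟨hz, by linarith [hpos 0]⟩
    obtain ⟨x, hx⟩ := ih (fun k => z k.succ / (1 - z 0)) (fun k => div_pos (hpos _) hz) (by
      rw [← Finset.sum_div, div_lt_one hz]
      linarith)
    refine ⟨Fin.cons a x, funext fun k => ?_⟩
    refine Fin.cases ?_ (fun k => ?_) k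
    · simp [stickBreak_apply_zero, logistic_eq_sigmoid, ha]
    · rw [stickBreak_apply_succ, Fin.tail_cons, Fin.cons_zero, logistic_eq_sigmoid, ha, hx]
      exact mul_div_cancel₀ _ hz.ne'

/-- The stick-breaking transformation is a bijection from `ℝ^K` onto the interior of
the reparameterization domain `{z : z_k > 0, ∑ z_k < 1}`. -/
theorem stickBreak_injective_range (K : ℕ) (hK : 1 ≤ K) :
    Function.Injective (stickBreak K) ∧
    Set.range (stickBreak K) =
      {z : Fin K → ℝ | (∀ k, 0 < z k) ∧ ∑ k, z k < 1} := by
  refine ⟨stickBreak_injective K, Set.Subset.antisymm ?_ ?_⟩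
  · rintro _ ⟨x, rfl⟩
    exact ⟨stickBreak_pos x, sum_stickBreak_lt_one x⟩
  · rintro z ⟨hpos, hsum⟩
    exact exists_stickBreak_eq z hpos hsum
end

section
/- Let d ≥ 1 and let z, z₀ ∈ Δ^{d−1} be vectors in the standard simplex of ℝ^d, and let θ > 0, θ₀ > 0 be real numbers. Then ‖θ·z − θ₀·z₀‖₂ ≥ |θ − θ₀|/(2√d) + θ₀·‖z − z₀‖₂/(8√d). -/
/-- A vector of the standard simplex has Euclidean norm at most one. -/
theorem EuclideanSpace.norm_le_one_of_sum_eq_one {ι : Type*} [Fintype ι]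
    {z : EuclideanSpace ℝ ι} (hz : ∀ k, 0 ≤ z k) (hsum : ∑ k, z k = 1) : ‖z‖ ≤ 1 := by
  rw [← sq_le_one_iff₀ (norm_nonneg z), EuclideanSpace.real_norm_sq_eq, ← hsum]
  refine Finset.sum_le_sum fun k _ => ?_
  have hk : z k ≤ 1 :=
    hsum ▸ Finset.single_le_sum (f := fun k => z k) (fun j _ => hz j) (Finset.mem_univ k)
  exact pow_le_of_le_one (hz k) hk two_ne_zero

/-- The coordinate sum is bounded by the Euclidean norm times the root of the dimension. -/
theorem EuclideanSpace.abs_sum_le_sqrt_card_mul_norm {ι : Type*} [Fintype ι]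
    (v : EuclideanSpace ℝ ι) : |∑ k, v k| ≤ Real.sqrt (Fintype.card ι) * ‖v‖ := by
  refine abs_le_of_sq_le_sq ?_ (mul_nonneg (Real.sqrt_nonneg _) (norm_nonneg v))
  rw [mul_pow, Real.sq_sqrt (Nat.cast_nonneg _), EuclideanSpace.real_norm_sq_eq]
  exact sq_sum_le_card_mul_sum_sq

/-- Separation inequality on the simplex: for `z, z₀` in the standard simplex of `ℝ^d`
and `θ, θ₀ > 0`, closeness of `θ z` to `θ₀ z₀` forces simultaneous closeness of `θ` to
`θ₀` and of `z` to `z₀`. -/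
theorem simplex_separation (d : ℕ) (hd : 1 ≤ d)
    (z z₀ : EuclideanSpace ℝ (Fin d))
    (hz_nonneg : ∀ k, 0 ≤ z k) (hz_sum : ∑ k, z k = 1)
    (hz₀_nonneg : ∀ k, 0 ≤ z₀ k) (hz₀_sum : ∑ k, z₀ k = 1)
    (θ θ₀ : ℝ) (hθ : 0 < θ) (hθ₀ : 0 < θ₀) :
    |θ - θ₀| / (2 * Real.sqrt d) + θ₀ * ‖z - z₀‖ / (8 * Real.sqrt d)
      ≤ ‖θ • z - θ₀ • z₀‖ := by
  have hsum : ∑ k, (θ • z - θ₀ • z₀) k = θ - θ₀ := by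
    simp [Finset.sum_sub_distrib, ← Finset.mul_sum, hz_sum, hz₀_sum]
  have hdeg : |θ - θ₀| ≤ Real.sqrt d * ‖θ • z - θ₀ • z₀‖ := by
    simpa only [hsum, Fintype.card_fin] using
      EuclideanSpace.abs_sum_le_sqrt_card_mul_norm (θ • z - θ₀ • z₀)
  have hprofile : θ₀ * ‖z - z₀‖ ≤ ‖θ • z - θ₀ • z₀‖ + |θ - θ₀| := by
    calc θ₀ * ‖z - z₀‖ = ‖(θ • z - θ₀ • z₀) - (θ - θ₀) • z‖ := by
          rw [← norm_smul_of_nonneg hθ₀.le]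
          congr 1
          module
      _ ≤ ‖θ • z - θ₀ • z₀‖ + |θ - θ₀| * ‖z‖ := by
          simpa only [norm_smul, Real.norm_eq_abs] using
            norm_sub_le (θ • z - θ₀ • z₀) ((θ - θ₀) • z)
      _ ≤ ‖θ • z - θ₀ • z₀‖ + |θ - θ₀| := by
          gcongr
          exact mul_le_of_le_one_right (abs_nonneg _)
            (EuclideanSpace.norm_le_one_of_sum_eq_one hz_nonneg hz_sum)
  have hsqrt : 1 ≤ Real.sqrt d := Real.one_le_sqrt.mpr (by exact_mod_cast hd)
  have hnorm : ‖θ • z - θ₀ • z₀‖ ≤ Real.sqrt d * ‖θ • z - θ₀ • z₀‖ :=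
    le_mul_of_one_le_left (norm_nonneg _) hsqrt
  have hpos : 0 < Real.sqrt d := one_pos.trans_le hsqrt
  rw [show |θ - θ₀| / (2 * Real.sqrt d) + θ₀ * ‖z - z₀‖ / (8 * Real.sqrt d)
      = (4 * |θ - θ₀| + θ₀ * ‖z - z₀‖) / (8 * Real.sqrt d) by field_simp; ring,
    div_le_iff₀ (by positivity)]
  linarith [norm_nonneg (θ • z - θ₀ • z₀)]
end

section
/- Let a < b and c > 0 be real numbers. Let η : ℝ → ℝ be continuously differentiable on [a, b] with η'(t) ≥ c for all t ∈ [a, b], and let B : ℝ → ℝ be differentiable on [a, b] with B'(t) = t·η'(t) for all t ∈ [a, b]. Then for all p, q ∈ [a, b]: (η(p) − η(q))·p − (B(p) − B(q)) = ∫_q^p η'(t)·(p − t) dt ≥ (c/2)·(p − q)². -/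
theorem integral_eq_sub_of_hasDerivWithinAt_Icc {a b p q : ℝ} {f f' : ℝ → ℝ}
    (hp : p ∈ Set.Icc a b) (hq : q ∈ Set.Icc a b)
    (hf : ∀ t ∈ Set.Icc a b, HasDerivWithinAt f (f' t) (Set.Icc a b) t)
    (hf' : ContinuousOn f' (Set.Icc a b)) :
    ∫ t in q..p, f' t = f p - f q := by
  have hsub : Set.uIcc q p ⊆ Set.Icc a b := Set.uIcc_subset_Icc hq hp
  refine intervalIntegral.integral_eq_sub_of_hasDeriv_right
    (fun t ht => ((hf t (hsub ht)).mono hsub).continuousWithinAt) (fun t ht => ?_)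
    (hf'.mono hsub).intervalIntegrable
  have hat : a < t := (le_min hq.1 hp.1).trans_lt ht.1
  have htb : t < b := ht.2.trans_le (max_le hq.2 hp.2)
  exact ((hf t ⟨hat.le, htb.le⟩).hasDerivAt (Icc_mem_nhds hat htb)).hasDerivWithinAt

theorem integral_mul_sub_nonneg {p q : ℝ} {g : ℝ → ℝ} (hg : ∀ t ∈ Set.uIcc q p, 0 ≤ g t) :
    0 ≤ ∫ t in q..p, g t * (p - t) := by
  rcases le_total q p with h | h
  · refine intervalIntegral.integral_nonneg h fun t ht => ?_
    exact mul_nonneg (hg t (Set.Icc_subset_uIcc ht)) (sub_nonneg.2 ht.2)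
  · rw [intervalIntegral.integral_symm, ← intervalIntegral.integral_neg]
    refine intervalIntegral.integral_nonneg h fun t ht => ?_
    rw [← mul_neg, neg_sub]
    exact mul_nonneg (hg t (Set.Icc_subset_uIcc' ht)) (sub_nonneg.2 ht.1)

/-- Kullback–Leibler divergence identity and quadratic lower bound for an exponential
family in its mean parametrization: `(η(p) − η(q))p − (B(p) − B(q)) = ∫_q^p η'(t)(p − t) dt
≥ (c/2)(p − q)²` whenever `η' ≥ c > 0` on `[a, b]`. -/
theorem expFamily_KL_identity_and_bound (a b c : ℝ) (hab : a < b) (hc : 0 < c)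
    (η B η' : ℝ → ℝ)
    (hη : ∀ t ∈ Set.Icc a b, HasDerivWithinAt η (η' t) (Set.Icc a b) t)
    (hη'cont : ContinuousOn η' (Set.Icc a b))
    (hη'c : ∀ t ∈ Set.Icc a b, c ≤ η' t)
    (hB : ∀ t ∈ Set.Icc a b, HasDerivWithinAt B (t * η' t) (Set.Icc a b) t) :
    ∀ p ∈ Set.Icc a b, ∀ q ∈ Set.Icc a b,
      ((η p - η q) * p - (B p - B q) = ∫ t in q..p, η' t * (p - t)) ∧
      (c / 2) * (p - q) ^ 2 ≤ (η p - η q) * p - (B p - B q) := by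
  intro p hp q hq
  have hF : ∀ t ∈ Set.Icc a b,
      HasDerivWithinAt (fun t => η t * p - B t) (η' t * (p - t)) (Set.Icc a b) t := by
    intro t ht
    exact (((hη t ht).mul_const p).sub (hB t ht)).congr_deriv (by ring)
  have hG : ∀ t ∈ Set.Icc a b,
      HasDerivWithinAt (fun t => η t * p - B t + c / 2 * (p - t) ^ 2)
        ((η' t - c) * (p - t)) (Set.Icc a b) t := by
    intro t ht
    have hsq := (((hasDerivWithinAt_id t (Set.Icc a b)).const_sub p).pow 2).const_mul (c / 2)
    refine ((hF t ht).add hsq).congr_deriv ?_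
    simp only [id_eq]
    ring
  have hFint := integral_eq_sub_of_hasDerivWithinAt_Icc hp hq hF (by fun_prop)
  have hGint := integral_eq_sub_of_hasDerivWithinAt_Icc hp hq hG (by fun_prop)
  have hnonneg := integral_mul_sub_nonneg (p := p) (q := q) (g := fun t => η' t - c)
    fun t ht => sub_nonneg.2 (hη'c t (Set.uIcc_subset_Icc hq hp ht))
  refine ⟨by rw [hFint]; ring, ?_⟩
  rw [hGint] at hnonneg
  linarith
end
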